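/- Let G be the parallel composition of multigraphs G1 and G2 at distinct vertices a and b, let s, t ∈ V1 \ {a, b} be distinct, and let r_a, r_s, r_t, r_b ∈ ℤ with r_a + r_s + r_t + r_b = 0. Then mincost(G, [a ↦ r_a, s ↦ r_s, t ↦ r_t, b ↦ r_b]) = ⨅_{r ∈ ℤ} ( mincost(G2, [a ↦ r, b ↦ −r]) + mincost(G1, [a ↦ r_a − r, s ↦ r_s, t ↦ r_t, b ↦ r_b + r]) ), where the infimum and addition are in ℕ∞. -/

import Mathlib

open scoped BigOperators

/-- An undirected multigraph on vertex type `V` with edge type `E`: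
each edge has a reference orientation `src e → tgt e`, a cost `c e` and a capacity `u e`. -/
structure Multigraph (V E : Type) where
  src : E → V
  tgt : E → V
  c : E → ℕ
  u : E → ℕ

variable {V E : Type}

/-- The residue of a flow assignment `f : E → ℤ` at a vertex `v`:
inflow (w.r.t. the reference orientation) minus outflow. -/
def Multigraph.residue [Fintype E] [DecidableEq V] (G : Multigraph V E)
    (f : E → ℤ) (v : V) : ℤ :=
  (∑ e : E, if G.tgt e = v then f e else 0) - (∑ e : E, if G.src e = v then f e else 0)

/-- `f` is an `r`-circulation supported on `F`: it vanishes outside `F`,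
respects capacities, and has residue `r v` at every vertex `v`. -/
def Multigraph.IsCirculation [Fintype E] [DecidableEq V] (G : Multigraph V E)
    (r : V → ℤ) (F : Finset E) (f : E → ℤ) : Prop :=
  (∀ e, e ∉ F → f e = 0) ∧ (∀ e, |f e| ≤ (G.u e : ℤ)) ∧ (∀ v, G.residue f v = r v)

/-- The minimum cost (in `ℕ∞`) of a subset `F` of the allowed edge set `E'`
admitting an `r`-circulation supported on `F`.  Taking `E' = Finset.univ`
gives `mincost(G, r)`; taking `E' = E₁` for a sub-multigraph `(V₁, E₁)` all of
whose edges have both endpoints in `V₁` gives `mincost(G₁, r)` whenever `r`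
vanishes outside `V₁`. -/
noncomputable def Multigraph.mincostOn [Fintype E] [DecidableEq V] (G : Multigraph V E)
    (E' : Finset E) (r : V → ℤ) : ℕ∞ :=
  ⨅ (F : Finset E) (_ : F ⊆ E' ∧ ∃ f : E → ℤ, G.IsCirculation r F f),
    ((∑ e ∈ F, G.c e : ℕ) : ℕ∞)

namespace Multigraph

variable [Fintype E] [DecidableEq V]

lemma residue_add (G : Multigraph V E) (f g : E → ℤ) (v : V) :
    G.residue (f + g) v = G.residue f v + G.residue g v := by
  simp only [residue, ← Finset.sum_filter, Pi.add_apply, Finset.sum_add_distrib]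
  ring

/-- The residues of a flow assignment sum to zero over all vertices. -/
lemma sum_residue [Fintype V] (G : Multigraph V E) (f : E → ℤ) :
    ∑ v, G.residue f v = 0 := by
  simp only [residue, Finset.sum_sub_distrib]
  rw [Finset.sum_comm, Finset.sum_comm (f := fun v e => if G.src e = v then f e else 0)]
  simp

/-- A flow assignment has zero residue at every vertex missed by all edges of its support. -/
lemma residue_eq_zero_of_notMem (G : Multigraph V E) {f : E → ℤ} {F : Finset E} {W : Finset V}
    (hf : ∀ e, e ∉ F → f e = 0) (hF : ∀ e ∈ F, G.src e ∈ W ∧ G.tgt e ∈ W)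
    {v : V} (hv : v ∉ W) : G.residue f v = 0 := by
  have hzero : ∀ e, (G.tgt e = v ∨ G.src e = v) → f e = 0 := by
    rintro e h
    refine hf e fun he => hv ?_
    rcases h with rfl | rfl
    exacts [(hF e he).2, (hF e he).1]
  rw [residue, Finset.sum_eq_zero, Finset.sum_eq_zero, sub_zero]
  · exact fun e _ => ite_eq_right_iff.2 fun h => hzero e (Or.inr h)
  · exact fun e _ => ite_eq_right_iff.2 fun h => hzero e (Or.inl h)

lemma mincostOn_le (G : Multigraph V E) {E' F : Finset E} {r : V → ℤ} {f : E → ℤ}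
    (hF : F ⊆ E') (hf : G.IsCirculation r F f) :
    G.mincostOn E' r ≤ ((∑ e ∈ F, G.c e : ℕ) : ℕ∞) :=
  iInf₂_le F ⟨hF, f, hf⟩

/-- A finite minimum cost is attained. -/
lemma exists_mincostOn_eq (G : Multigraph V E) {E' : Finset E} {r : V → ℤ}
    (h : G.mincostOn E' r ≠ ⊤) :
    ∃ F ⊆ E', ∃ f, G.IsCirculation r F f ∧
      G.mincostOn E' r = ((∑ e ∈ F, G.c e : ℕ) : ℕ∞) := by
  obtain ⟨n, hn⟩ := ENat.ne_top_iff_exists.1 h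
  have hlt : G.mincostOn E' r < ((n + 1 : ℕ) : ℕ∞) := by
    rw [← hn]
    exact_mod_cast n.lt_succ_self
  have hlt' := hlt
  rw [mincostOn] at hlt'
  simp only [iInf_lt_iff] at hlt'
  obtain ⟨F, ⟨hF, f, hf⟩, hc⟩ := hlt'
  refine ⟨F, hF, f, hf, (G.mincostOn_le hF hf).antisymm ?_⟩
  rw [← hn]
  exact_mod_cast Nat.lt_succ_iff.1 (by exact_mod_cast hc)

variable [DecidableEq E]

/-- Circulations with disjoint supports can be added. -/
lemma IsCirculation.add {G : Multigraph V E} {r₁ r₂ : V → ℤ} {F₁ F₂ : Finset E} {f₁ f₂ : E → ℤ}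
    (h₁ : G.IsCirculation r₁ F₁ f₁) (h₂ : G.IsCirculation r₂ F₂ f₂) (h : Disjoint F₁ F₂) :
    G.IsCirculation (r₁ + r₂) (F₁ ∪ F₂) (f₁ + f₂) := by
  refine ⟨fun e he => ?_, fun e => ?_, fun v => ?_⟩
  · rw [Finset.notMem_union] at he
    simp [h₁.1 e he.1, h₂.1 e he.2]
  · by_cases he : e ∈ F₁
    · simpa [h₂.1 e (Finset.disjoint_left.1 h he)] using h₁.2.1 e
    · simpa [h₁.1 e he] using h₂.2.1 e
  · rw [residue_add, h₁.2.2, h₂.2.2, Pi.add_apply]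

/-- Restricting a circulation to a set of edges. -/
lemma IsCirculation.restrict {G : Multigraph V E} {r : V → ℤ} {F : Finset E} {f : E → ℤ}
    (h : G.IsCirculation r F f) (E' : Finset E) :
    G.IsCirculation (G.residue fun e => if e ∈ E' then f e else 0) (F ∩ E')
      (fun e => if e ∈ E' then f e else 0) := by
  refine ⟨fun e he => ?_, fun e => ?_, fun v => rfl⟩
  · refine ite_eq_right_iff.2 fun hE => h.1 e fun hF => he (Finset.mem_inter.2 ⟨hF, hE⟩)
  · dsimp only
    split_ifs
    · exact h.2.1 e
    · simp

/-- Minimum cost is subadditive over disjoint edge sets. -/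
lemma mincostOn_union_add_le (G : Multigraph V E) {E₁ E₂ : Finset E} (h : Disjoint E₁ E₂)
    (r₁ r₂ : V → ℤ) :
    G.mincostOn (E₁ ∪ E₂) (r₁ + r₂) ≤ G.mincostOn E₁ r₁ + G.mincostOn E₂ r₂ := by
  by_cases h₁ : G.mincostOn E₁ r₁ = ⊤
  · simp [h₁]
  by_cases h₂ : G.mincostOn E₂ r₂ = ⊤
  · simp [h₂]
  obtain ⟨F₁, hF₁, f₁, hf₁, hc₁⟩ := G.exists_mincostOn_eq h₁
  obtain ⟨F₂, hF₂, f₂, hf₂, hc₂⟩ := G.exists_mincostOn_eq h₂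
  have hF : Disjoint F₁ F₂ := h.mono hF₁ hF₂
  rw [hc₁, hc₂, ← Nat.cast_add, ← Finset.sum_union hF]
  exact G.mincostOn_le (Finset.union_subset_union hF₁ hF₂) (hf₁.add hf₂ hF)

end Multigraph

/-- Case 3.4: parallel composition with `s` and `t` in the same parallel component. -/
theorem parallel_four_tuple_same_component {V E : Type}
    [Fintype V] [Fintype E] [DecidableEq V] [DecidableEq E]
    (G : Multigraph V E) (V1 V2 : Finset V) (E1 E2 : Finset E)
    (hE : E1 ∪ E2 = Finset.univ) (hEdisj : Disjoint E1 E2)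
    (hV : V1 ∪ V2 = Finset.univ)
    (hG1 : ∀ e ∈ E1, G.src e ∈ V1 ∧ G.tgt e ∈ V1)
    (hG2 : ∀ e ∈ E2, G.src e ∈ V2 ∧ G.tgt e ∈ V2)
    (a b s t : V) (hab : a ≠ b) (hVab : V1 ∩ V2 = {a, b})
    (hs : s ∈ V1) (hsa : s ≠ a) (hsb : s ≠ b)
    (ht : t ∈ V1) (hta : t ≠ a) (htb : t ≠ b) (hst : s ≠ t)
    (ra rs rt rb : ℤ) (hsum : ra + rs + rt + rb = 0) :
    G.mincostOn Finset.univ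
        (fun v => if v = a then ra else if v = s then rs else if v = t then rt
          else if v = b then rb else 0) =
      ⨅ r : ℤ,
        G.mincostOn E2 (fun v => if v = a then r else if v = b then -r else 0) +
        G.mincostOn E1
          (fun v => if v = a then ra - r else if v = s then rs else if v = t then rt
            else if v = b then rb + r else 0) := by
  have huniv : E2 ∪ E1 = Finset.univ := by rw [Finset.union_comm, hE]
  apply le_antisymm
  · refine le_iInf fun r => ?_
    refine le_trans (le_of_eq ?_) (G.mincostOn_union_add_le hEdisj.symm _ _)
    rw [huniv]
    congr 1
    funext v
    simp only [Pi.add_apply]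
    split_ifs <;> simp_all
  · refine le_iInf₂ fun F ⟨_, f, hf⟩ => ?_
    set f1 : E → ℤ := fun e => if e ∈ E1 then f e else 0 with hf1
    set f2 : E → ℤ := fun e => if e ∈ E2 then f e else 0 with hf2
    have hadd : f = f1 + f2 := by
      funext e
      have hmem : e ∈ E1 ∪ E2 := hE ▸ Finset.mem_univ e
      by_cases he : e ∈ E1
      · simp [hf1, hf2, he, Finset.disjoint_left.1 hEdisj he]
      · simp [hf1, hf2, he, (Finset.mem_union.1 hmem).resolve_left he]
    have hres : ∀ v, G.residue f v = G.residue f1 v + G.residue f2 v := fun v => by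
      rw [← G.residue_add, ← hadd]
    have hz1 : ∀ v, v ∉ V1 → G.residue f1 v = 0 := fun v =>
      G.residue_eq_zero_of_notMem (fun e he => if_neg he) hG1
    have hz2 : ∀ v, v ∉ V2 → G.residue f2 v = 0 := fun v =>
      G.residue_eq_zero_of_notMem (fun e he => if_neg he) hG2
    have hz : ∀ v, v ≠ a → v ≠ b → G.residue f2 v = 0 := by
      intro v hva hvb
      by_cases hv2 : v ∈ V2
      · have hv1 : v ∉ V1 := fun hv1 => by
          have : v ∈ V1 ∩ V2 := Finset.mem_inter.2 ⟨hv1, hv2⟩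
          simp [hVab, hva, hvb] at this
        have hvs : v ≠ s := fun h => hv1 (h ▸ hs)
        have hvt : v ≠ t := fun h => hv1 (h ▸ ht)
        have h := hf.2.2 v
        rw [hres, hz1 v hv1] at h
        simpa [hva, hvb, hvs, hvt] using h
      · exact hz2 v hv2
    have hb : G.residue f2 b = -G.residue f2 a := by
      have h := G.sum_residue f2
      rw [Fintype.sum_eq_add a b hab fun v hv => hz v hv.1 hv.2] at h
      linarith
    have hr2 : G.residue f2 = fun v =>
        if v = a then G.residue f2 a else if v = b then -G.residue f2 a else 0 := by
      funext v
      split_ifs with h h'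
      · rw [h]
      · rw [h', hb]
      · exact hz v h h'
    have hr1 : G.residue f1 = fun v =>
        if v = a then ra - G.residue f2 a else if v = s then rs else if v = t then rt
          else if v = b then rb + G.residue f2 a else 0 := by
      funext v
      have h := hf.2.2 v
      rw [hres, congrFun hr2 v] at h
      dsimp only at h
      split_ifs at h ⊢ <;> grind
    have hc1 := hf.restrict E1
    have hc2 := hf.restrict E2
    rw [← hf1, hr1] at hc1
    rw [← hf2, hr2] at hc2
    refine iInf_le_of_le (G.residue f2 a) ?_
    have hcost : ∑ e ∈ F, G.c e = ∑ e ∈ F ∩ E2, G.c e + ∑ e ∈ F ∩ E1, G.c e := by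
      rw [← Finset.sum_union (hEdisj.symm.mono Finset.inter_subset_right
        Finset.inter_subset_right), ← Finset.inter_union_distrib_left, huniv, Finset.inter_univ]
    rw [hcost, Nat.cast_add]
    exact add_le_add (G.mincostOn_le Finset.inter_subset_right hc2)
      (G.mincostOn_le Finset.inter_subset_right hc1)
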